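/- arXiv:1401.1607 — 4 statements merged into one kernel-verified Lean document; each statement's English description precedes it below -/
import Mathlib

section
/- Let R be an infinite field and A an R-algebra (not necessarily commutative). Then A is an R-futile R-algebra if and only if A is isomorphic as an R-algebra to R[x]/(f), where f ∈ R[x] is a nonzero polynomial whose factorization into irreducible factors is f = ∏_{i=1}^m f_i^{n_i} with all f_i monic, irreducible and pairwise coprime, such that n_i = 1 for all but possibly one index i, and for that exceptional index i one has deg(f_i) = 1 and n_i ≤ 3. -/
/-- An `R`-algebra `A` is *futile* if it has only finitely many `R`-subalgebras. -/
def IsFutile (R A : Type*) [CommRing R] [Ring A] [Algebra R A] : Prop :=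
  Finite (Subalgebra R A)

open Polynomial

section Transfer

variable {R A B : Type*} [CommRing R] [Ring A] [Algebra R A] [Ring B] [Algebra R B]

theorem IsFutile.of_injective (hB : IsFutile R B) (φ : A →ₐ[R] B) (hφ : Function.Injective φ) :
    IsFutile R A :=
  have : Finite (Subalgebra R B) := hB
  Finite.of_injective _ (Subalgebra.map_injective hφ)

theorem isFutile_congr (e : A ≃ₐ[R] B) : IsFutile R A ↔ IsFutile R B :=
  ⟨fun h => h.of_injective e.symm.toAlgHom e.symm.injective,
    fun h => h.of_injective e.toAlgHom e.injective⟩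

theorem IsFutile.of_subsingleton [Subsingleton A] : IsFutile R A :=
  Finite.of_injective (β := Set A) (fun S => (S : Set A)) SetLike.coe_injective

end Transfer

section Field

variable {R : Type*} [Field R]

/-- If `K` is a field, a subalgebra of `A × K` is either a product of subalgebras or the graph of
an algebra homomorphism from a subalgebra of `A` to `K`. -/
theorem IsFutile.prod_field {A K : Type*} [Ring A] [Algebra R A] [Module.Finite R A]
    [Field K] [Algebra R K] [Algebra.IsAlgebraic R K] (hA : IsFutile R A) (hK : IsFutile R K) :
    IsFutile R (A × K) := by
  have : Finite (Subalgebra R A) := hA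
  have : Finite (Subalgebra R K) := hK
  let F : (Subalgebra R A × Subalgebra R K) ⊕ (Σ S : Subalgebra R A, S →ₐ[R] K) →
      Subalgebra R (A × K) :=
    Sum.elim (fun p => p.1.prod p.2) (fun p => (p.1.val.prod p.2).range)
  have : ∀ S : Subalgebra R A, Finite (S →ₐ[R] K) := fun S =>
    have : Module.Finite R S := inferInstanceAs (Module.Finite R S.toSubmodule)
    Fintype.finite (minpoly.AlgHom.fintype R S K)
  refine Finite.of_surjective F fun B => ?_
  let π₁ : B →ₐ[R] A := (AlgHom.fst R A K).comp B.val
  by_cases h : ∃ k : K, k ≠ 0 ∧ ((0 : A), k) ∈ B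
  · obtain ⟨k, hk, hkB⟩ := h
    refine ⟨Sum.inl (B.map (AlgHom.fst R A K), B.map (AlgHom.snd R A K)), ?_⟩
    have hinv : k⁻¹ ∈ B.map (AlgHom.snd R A K) :=
      Subalgebra.inv_mem_of_algebraic (B.map (AlgHom.snd R A K)) (x := ⟨k, (0, k), hkB, rfl⟩)
        (Algebra.IsAlgebraic.isAlgebraic (R := R) k)
    obtain ⟨⟨a, l⟩, hal, hl⟩ := hinv
    replace hl : l = k⁻¹ := hl
    have hone : ((0 : A), (1 : K)) ∈ B := by
      simpa [hl, hk] using B.mul_mem hkB hal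
    refine le_antisymm ?_ fun x hx => ⟨⟨x, hx, rfl⟩, ⟨x, hx, rfl⟩⟩
    rintro ⟨x, y⟩ ⟨⟨⟨x', y'⟩, hB, hx⟩, ⟨⟨x'', y''⟩, hB', hy⟩⟩
    replace hx : x' = x := hx
    replace hy : y'' = y := hy
    subst hx hy
    have h₁ := B.mul_mem hone hB'
    have h₂ := B.mul_mem (B.sub_mem B.one_mem hone) hB
    have h₃ : ((0 : A), (1 : K)) * (x'', y'') + (1 - (0, 1)) * (x', y') = (x', y'') := by
      ext <;> simp
    exact h₃ ▸ B.add_mem h₁ h₂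
  · have hinj : Function.Injective π₁ := by
      rw [injective_iff_map_eq_zero]
      rintro ⟨⟨a, k⟩, hak⟩ ha
      replace ha : a = 0 := ha
      subst ha
      by_contra hne
      exact h ⟨k, fun hk => hne (by subst hk; rfl), hak⟩
    let e := AlgEquiv.ofInjective π₁ hinj
    refine ⟨Sum.inr ⟨π₁.range, ((AlgHom.snd R A K).comp B.val).comp e.symm.toAlgHom⟩, ?_⟩
    ext x
    constructor
    · rintro ⟨y, rfl⟩
      obtain ⟨b, rfl⟩ := e.surjective y
      have : ((π₁.range.val.prod
          (((AlgHom.snd R A K).comp B.val).comp e.symm.toAlgHom)) (e b)) = (b : A × K) := by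
        ext
        · rfl
        · simp
      exact this ▸ b.2
    · intro hx
      refine ⟨e ⟨x, hx⟩, ?_⟩
      ext
      · rfl
      · simp

theorem isFutile_adjoinRoot_of_irreducible {g : R[X]} (hg : Irreducible g) :
    IsFutile R (AdjoinRoot g) := by
  have : Fact (Irreducible g) := ⟨hg⟩
  have : Module.Finite R (AdjoinRoot g) := (AdjoinRoot.powerBasis hg.ne_zero).finite
  have : Finite (IntermediateField R (AdjoinRoot g)) :=
    Field.finite_intermediateField_of_exists_primitive_element R (AdjoinRoot g)
      ⟨AdjoinRoot.root g, by
        rw [eq_top_iff, ← IntermediateField.toSubalgebra_le_toSubalgebra]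
        exact (AdjoinRoot.adjoinRoot_eq_top (f := g)).ge.trans
          (IntermediateField.algebra_adjoin_le_adjoin _ _)⟩
  exact Finite.of_injective _ (subalgebraEquivIntermediateField (K := R)
    (L := AdjoinRoot g)).injective

theorem IsFutile.adjoinRoot_mul {f g : R[X]} (hf : f ≠ 0) (hfut : IsFutile R (AdjoinRoot f))
    (hg : Irreducible g) (hfg : IsCoprime f g) : IsFutile R (AdjoinRoot (f * g)) := by
  have : Fact (Irreducible g) := ⟨hg⟩
  have : Module.Finite R (AdjoinRoot f) := (AdjoinRoot.powerBasis hf).finite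
  have : Module.Finite R (AdjoinRoot g) := (AdjoinRoot.powerBasis hg.ne_zero).finite
  refine (hfut.prod_field (isFutile_adjoinRoot_of_irreducible hg)).of_injective
    ((AdjoinRoot.algHomOfDvd R (f * g) f (Dvd.intro g rfl)).prod
      (AdjoinRoot.algHomOfDvd R (f * g) g (Dvd.intro_left f rfl))) ?_
  rw [injective_iff_map_eq_zero]
  intro x hx
  obtain ⟨p, rfl⟩ := AdjoinRoot.mk_surjective x
  rw [AlgHom.prod_apply, Prod.mk_eq_zero, ← AdjoinRoot.aeval_eq, ← aeval_algHom_apply,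
    ← aeval_algHom_apply, AdjoinRoot.algHomOfDvd_root, AdjoinRoot.algHomOfDvd_root,
    AdjoinRoot.aeval_eq, AdjoinRoot.aeval_eq, AdjoinRoot.mk_eq_zero, AdjoinRoot.mk_eq_zero] at hx
  rw [AdjoinRoot.mk_eq_zero]
  exact hfg.mul_dvd hx.1 hx.2

theorem isFutile_of_pow_three_eq_zero {A : Type*} [Ring A] [Algebra R A] {t : A}
    (ht : t ^ 3 = 0) (htop : Algebra.adjoin R {t} = ⊤) : IsFutile R A := by
  have hrep : ∀ x : A, ∃ a b c : R, x = algebraMap R A a + b • t + c • t ^ 2 := by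
    intro x
    have hx : x ∈ Algebra.adjoin R {t} := htop ▸ Algebra.mem_top
    rw [Algebra.adjoin_singleton_eq_range_aeval] at hx
    obtain ⟨p, rfl⟩ := hx
    refine ⟨p.coeff 0, p.coeff 1, p.coeff 2, ?_⟩
    have hp : p = X ^ 3 * p.divX.divX.divX + C (p.coeff 2) * X ^ 2 + C (p.coeff 1) * X
        + C (p.coeff 0) := by
      have h0 := divX_mul_X_add p
      have h1 := divX_mul_X_add p.divX
      have h2 := divX_mul_X_add p.divX.divX
      simp only [coeff_divX] at h1 h2
      norm_num at h1 h2
      linear_combination -h0 - X * h1 - X ^ 2 * h2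
    change aeval t p = _
    conv_lhs => rw [hp]
    simp [ht, Algebra.smul_def]
    abel
  have key : ∀ S : Subalgebra R A, S = ⊥ ∨ S = Algebra.adjoin R {t ^ 2} ∨ S = ⊤ := by
    intro S
    by_cases h₁ : ∃ a b c : R, b ≠ 0 ∧ algebraMap R A a + b • t + c • t ^ 2 ∈ S
    · obtain ⟨a, b, c, hb, hS⟩ := h₁
      have hu : t + (b⁻¹ * c) • t ^ 2 ∈ S := by
        have := S.smul_mem (S.sub_mem hS (S.algebraMap_mem a)) b⁻¹
        rw [add_assoc, add_sub_cancel_left, smul_add, smul_smul, smul_smul,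
          inv_mul_cancel₀ hb, one_smul] at this
        exact this
      have h4 : t ^ 4 = 0 := by rw [pow_succ, ht, zero_mul]
      have ht2 : t ^ 2 ∈ S := by
        have := S.mul_mem hu hu
        simp only [mul_add, add_mul, smul_mul_assoc, mul_smul_comm, ← pow_succ, ← pow_succ',
          ← pow_add, ht, h4, smul_zero, add_zero] at this
        simpa [sq] using this
      refine Or.inr (Or.inr (eq_top_iff.2 (htop ▸ Algebra.adjoin_le ?_)))
      rw [Set.singleton_subset_iff]
      simpa using S.sub_mem hu (S.smul_mem ht2 (b⁻¹ * c))
    · push Not at h₁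
      have hrep' : ∀ x ∈ S, ∃ a c : R, x = algebraMap R A a + c • t ^ 2 := by
        intro x hx
        obtain ⟨a, b, c, rfl⟩ := hrep x
        have hb : b = 0 := by
          by_contra hb
          exact h₁ a b c hb hx
        exact ⟨a, c, by simp [hb]⟩
      by_cases ht2 : t ^ 2 ∈ S
      · refine Or.inr (Or.inl (le_antisymm (fun x hx => ?_) (Algebra.adjoin_le (by simpa))))
        obtain ⟨a, c, rfl⟩ := hrep' x hx
        exact add_mem (Subalgebra.algebraMap_mem _ a)
          (Subalgebra.smul_mem _ (Algebra.self_mem_adjoin_singleton R _) c)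
      · refine Or.inl (eq_bot_iff.2 fun x hx => ?_)
        obtain ⟨a, c, rfl⟩ := hrep' x hx
        have hc : c = 0 := by
          by_contra hc
          refine ht2 ?_
          have := S.smul_mem (S.sub_mem hx (S.algebraMap_mem a)) c⁻¹
          simpa [smul_smul, hc] using this
        exact Algebra.mem_bot.2 ⟨a, by simp [hc]⟩
  exact Set.finite_univ_iff.1 ((Set.toFinite {⊥, Algebra.adjoin R {t ^ 2}, ⊤}).subset
    fun S _ => by simpa using key S)

theorem isFutile_adjoinRoot_X_sub_C_pow (a : R) {n : ℕ} (hn : n ≤ 3) :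
    IsFutile R (AdjoinRoot ((X - C a) ^ n)) := by
  refine isFutile_of_pow_three_eq_zero (t := AdjoinRoot.mk _ (X - C a)) ?_ ?_
  · rw [← map_pow, AdjoinRoot.mk_eq_zero]
    exact pow_dvd_pow _ hn
  · rw [eq_top_iff, ← AdjoinRoot.adjoinRoot_eq_top]
    refine Algebra.adjoin_le (Set.singleton_subset_iff.2 ?_)
    have h := add_mem (Algebra.self_mem_adjoin_singleton R
      (AdjoinRoot.mk ((X - C a) ^ n) (X - C a))) (Subalgebra.algebraMap_mem _ a)
    rwa [map_sub, AdjoinRoot.mk_X, AdjoinRoot.mk_C, AdjoinRoot.algebraMap_eq,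
      sub_add_cancel] at h

theorem IsFutile.adjoinRoot_mul_prod {ι : Type*} {f : R[X]} (hf : f ≠ 0)
    (hfut : IsFutile R (AdjoinRoot f)) {g : ι → R[X]} (hg : ∀ i, Irreducible (g i))
    (hco : Pairwise fun i j => IsCoprime (g i) (g j)) (s : Finset ι)
    (hfg : ∀ i ∈ s, IsCoprime f (g i)) : IsFutile R (AdjoinRoot (f * ∏ i ∈ s, g i)) := by
  classical
  induction s using Finset.induction_on with
  | empty => rwa [Finset.prod_empty, mul_one]
  | insert i s hi ih =>
    rw [Finset.prod_insert hi, mul_comm (g i), ← mul_assoc]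
    refine (ih fun j hj => hfg j (Finset.mem_insert_of_mem hj)).adjoinRoot_mul
      (mul_ne_zero hf (Finset.prod_ne_zero_iff.2 fun j _ => (hg j).ne_zero)) (hg i) ?_
    refine (hfg i (Finset.mem_insert_self i s)).mul_left (IsCoprime.prod_left fun j hj => hco ?_)
    rintro rfl
    exact hi hj

theorem isFutile_adjoinRoot_prod {ι : Type*} [Fintype ι] {g : ι → R[X]} {n : ι → ℕ}
    (hg : ∀ i, (g i).Monic ∧ Irreducible (g i))
    (hco : Pairwise fun i j => IsCoprime (g i) (g j))
    (hn : ∀ i, n i ≠ 1 → (g i).degree = 1 ∧ n i ≤ 3 ∧ ∀ j, n j ≠ 1 → j = i) :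
    IsFutile R (AdjoinRoot (∏ i, g i ^ n i)) := by
  classical
  by_cases h : ∃ i, n i ≠ 1
  · obtain ⟨i, hi⟩ := h
    obtain ⟨hdeg, hle, huniq⟩ := hn i hi
    have hgi : g i = X - C (-(g i).coeff 0) := by
      conv_lhs => rw [(hg i).1.eq_X_add_C (natDegree_eq_of_degree_eq_some hdeg)]
      simp
    have hprod : ∏ j, g j ^ n j = g i ^ n i * ∏ j ∈ Finset.univ.erase i, g j := by
      rw [← Finset.mul_prod_erase _ _ (Finset.mem_univ i)]
      congr 1
      refine Finset.prod_congr rfl fun j hj => ?_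
      have : n j = 1 := by
        by_contra hj'
        exact (Finset.mem_erase.1 hj).1 (huniq j hj')
      rw [this, pow_one]
    rw [hprod]
    refine IsFutile.adjoinRoot_mul_prod (pow_ne_zero _ (hg i).2.ne_zero) ?_
      (fun j => (hg j).2) hco _ fun j hj => (hco (Finset.mem_erase.1 hj).1.symm).pow_left
    rw [hgi]
    exact isFutile_adjoinRoot_X_sub_C_pow _ hle
  · push Not at h
    have hone : Subsingleton (AdjoinRoot (1 : R[X])) :=
      subsingleton_of_zero_eq_one (AdjoinRoot.mk_self.symm.trans (map_one _))
    rw [show ∏ i, g i ^ n i = 1 * ∏ i, g i by simp [h]]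
    exact IsFutile.adjoinRoot_mul_prod one_ne_zero
      (IsFutile.of_subsingleton (R := R) (A := AdjoinRoot (1 : R[X]))) (fun j => (hg j).2) hco
      Finset.univ fun j _ => isCoprime_one_left

/-- The elements `g * (X + c)` of `R[X] / (g * h)` square to zero and generate pairwise distinct
subalgebras. -/
theorem not_isFutile_adjoinRoot_mul [Infinite R] {g h : R[X]} (hg : g ≠ 0) (hdvd : h ∣ g)
    (hdeg : 2 ≤ h.natDegree) : ¬ IsFutile R (AdjoinRoot (g * h)) := by
  intro hfin
  have : Finite (Subalgebra R (AdjoinRoot (g * h))) := hfin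
  let u : R → AdjoinRoot (g * h) := fun c => AdjoinRoot.mk _ (g * (X + C c))
  have hu : ∀ c, u c ^ 2 = 0 := by
    intro c
    rw [← map_pow, AdjoinRoot.mk_eq_zero]
    obtain ⟨k, hk⟩ := hdvd
    exact ⟨k * (X + C c) ^ 2, by linear_combination g * (X + C c) ^ 2 * hk⟩
  refine not_injective_infinite_finite (fun c => Algebra.adjoin R {u c}) fun c d hcd => ?_
  have hmem : u d ∈ Algebra.adjoin R {u c} := by
    have := Algebra.self_mem_adjoin_singleton R (u d)
    rwa [← show Algebra.adjoin R {u c} = Algebra.adjoin R {u d} from hcd] at this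
  rw [Algebra.adjoin_singleton_eq_range_aeval] at hmem
  obtain ⟨p, hp⟩ := hmem
  have hp' : aeval (u c) p = AdjoinRoot.mk _ (C (p.coeff 0) + C (p.coeff 1) * (g * (X + C c))) := by
    have h0 := divX_mul_X_add p
    have h1 := divX_mul_X_add p.divX
    rw [← h1] at h0
    have hc : aeval (u c) p = algebraMap R _ (p.coeff 0) + algebraMap R _ (p.coeff 1) * u c := by
      conv_lhs => rw [← h0]
      simp only [map_add, map_mul, aeval_X, aeval_C, coeff_divX, zero_add]
      linear_combination aeval (u c) p.divX.divX * hu c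
    rw [hc, map_add, map_mul, AdjoinRoot.mk_C, AdjoinRoot.mk_C, AdjoinRoot.algebraMap_eq]
  have hdiv : g * h ∣ C (p.coeff 0) + C (p.coeff 1) * (g * (X + C c)) - g * (X + C d) := by
    rw [← AdjoinRoot.mk_eq_zero, map_sub, ← hp', sub_eq_zero]
    exact hp
  have hcoeff : p.coeff 0 = 0 := by
    have h1 : g ∣ C (p.coeff 0) := by
      have h2 := (Dvd.intro _ rfl).trans hdiv
      have h3 : g ∣ C (p.coeff 1) * (g * (X + C c)) - g * (X + C d) :=
        ⟨C (p.coeff 1) * (X + C c) - (X + C d), by ring⟩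
      rw [add_sub_assoc] at h2
      exact (dvd_add_left h3).1 h2
    have h4 := eq_zero_of_dvd_of_natDegree_lt (hdvd.trans h1) (by rw [natDegree_C]; omega)
    simpa using h4
  rw [hcoeff, C_0, zero_add, show C (p.coeff 1) * (g * (X + C c)) - g * (X + C d) =
    g * (C (p.coeff 1) * (X + C c) - (X + C d)) by ring, mul_dvd_mul_iff_left hg] at hdiv
  have hlin := eq_zero_of_dvd_of_natDegree_lt hdiv
    (lt_of_le_of_lt (b := 1) (by compute_degree) hdeg)
  have e0 := congrArg (coeff · 0) hlin
  have e1 := congrArg (coeff · 1) hlin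
  simp [coeff_X, coeff_C] at e0 e1
  rw [sub_eq_zero] at e0 e1
  simpa [e1] using e0

theorem not_isFutile_polynomial : ¬ IsFutile R R[X] := by
  intro hfin
  have : Finite (Subalgebra R R[X]) := hfin
  have hdvd : ∀ k l : ℕ, Algebra.adjoin R {(X : R[X]) ^ (k + 1)} = Algebra.adjoin R {X ^ (l + 1)} →
      k + 1 ∣ l + 1 := by
    intro k l hkl
    have hmem := Algebra.self_mem_adjoin_singleton R ((X : R[X]) ^ (l + 1))
    rw [← hkl, Algebra.adjoin_singleton_eq_range_aeval] at hmem
    obtain ⟨p, hp⟩ := hmem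
    replace hp : expand R (k + 1) p = X ^ (l + 1) := by
      rw [expand_eq_comp_X_pow, comp_eq_aeval]
      exact hp
    by_contra hnd
    have := congrArg (coeff · (l + 1)) hp
    simp [coeff_expand, hnd] at this
  refine not_injective_infinite_finite
    (fun k : ℕ => Algebra.adjoin R {(X : R[X]) ^ (k + 1)}) fun k l hkl => ?_
  exact Nat.succ_injective (Nat.dvd_antisymm (hdvd k l hkl) (hdvd l k hkl.symm))

theorem IsFutile.exists_adjoin_singleton_eq_top [Infinite R] {A : Type*} [Ring A] [Algebra R A]
    (hA : IsFutile R A) : ∃ a : A, Algebra.adjoin R {a} = ⊤ := by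
  have : Finite (Subalgebra R A) := hA
  obtain ⟨⟨_, a, rfl⟩, ha⟩ := Subspace.exists_eq_top_of_iUnion_eq_univ
    (p := fun S : Set.range fun a : A => Algebra.adjoin R {a} => Subalgebra.toSubmodule S.1)
    (Set.eq_univ_of_forall fun a => Set.mem_iUnion.2
      ⟨⟨_, a, rfl⟩, Algebra.self_mem_adjoin_singleton R a⟩)
  exact ⟨a, Algebra.toSubmodule_eq_top.1 ha⟩

theorem IsFutile.exists_equiv_adjoinRoot [Infinite R] {A : Type*} [Ring A] [Algebra R A]
    (hA : IsFutile R A) : ∃ f : R[X], f.Monic ∧ Nonempty (A ≃ₐ[R] AdjoinRoot f) := by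
  classical
  obtain ⟨a, ha⟩ := hA.exists_adjoin_singleton_eq_top
  have hsurj : Function.Surjective (aeval a : R[X] →ₐ[R] A) := by
    rw [← AlgHom.range_eq_top, ← Algebra.adjoin_singleton_eq_range_aeval, ha]
  obtain ⟨f, hf⟩ := IsPrincipalIdealRing.principal (RingHom.ker (aeval a : R[X] →ₐ[R] A))
  replace hf : RingHom.ker (aeval a : R[X] →ₐ[R] A) = Ideal.span {f} := hf
  have hf0 : f ≠ 0 := by
    rintro rfl
    have hinj : Function.Injective (aeval a : R[X] →ₐ[R] A) := by
      rw [injective_iff_map_eq_zero]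
      intro p hp
      have hp' : p ∈ RingHom.ker (aeval a : R[X] →ₐ[R] A) := hp
      simpa [hf] using hp'
    exact not_isFutile_polynomial (hA.of_injective _ hinj)
  have hspan : RingHom.ker (aeval a : R[X] →ₐ[R] A) = Ideal.span {normalize f} := by
    rw [hf, Ideal.span_singleton_eq_span_singleton]
    exact (normalize_associated f).symm
  exact ⟨normalize f, monic_normalize hf0,
    ⟨((Ideal.quotientEquivAlgOfEq R hspan.symm).trans
      (Ideal.quotientKerAlgEquivOfSurjective hsurj)).symm⟩⟩

theorem exists_prod_irreducible_pow {f : R[X]} (hf : f.Monic) :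
    ∃ (m : ℕ) (g : Fin m → R[X]) (n : Fin m → ℕ), f = ∏ i, g i ^ n i ∧
      (∀ i, (g i).Monic ∧ Irreducible (g i)) ∧
      (Pairwise fun i j => IsCoprime (g i) (g j)) ∧ ∀ i, 1 ≤ n i := by
  classical
  let s := (UniqueFactorizationMonoid.normalizedFactors f).toFinset
  let e := s.equivFin
  have hmem : ∀ i, (e.symm i : R[X]) ∈ UniqueFactorizationMonoid.normalizedFactors f :=
    fun i => Multiset.mem_toFinset.1 (e.symm i).2
  have hirr := fun i => UniqueFactorizationMonoid.irreducible_of_normalized_factor _ (hmem i)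
  have hmonic : ∀ i, (e.symm i : R[X]).Monic := fun i => by
    rw [← UniqueFactorizationMonoid.normalize_normalized_factor _ (hmem i)]
    exact monic_normalize (hirr i).ne_zero
  refine ⟨s.card, fun i => e.symm i,
    fun i => (UniqueFactorizationMonoid.normalizedFactors f).count (e.symm i : R[X]),
    ?_, fun i => ⟨hmonic i, hirr i⟩, fun i j hij => ?_,
    fun i => Multiset.one_le_count_iff_mem.2 (hmem i)⟩
  · rw [e.symm.prod_comp (fun x : s => (x : R[X]) ^
      (UniqueFactorizationMonoid.normalizedFactors f).count (x : R[X])),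
      Finset.prod_coe_sort s (fun x => x ^
      (UniqueFactorizationMonoid.normalizedFactors f).count x),
      ← Finset.prod_multiset_count, UniqueFactorizationMonoid.prod_normalizedFactors_eq hf.ne_zero,
      hf.normalize_eq_self]
  · refine (hirr i).coprime_iff_not_dvd.2 fun hd => ?_
    refine hij (e.symm.injective (Subtype.ext ?_))
    exact eq_of_monic_of_associated (hmonic i) (hmonic j) ((hirr i).associated_of_dvd (hirr j) hd)

theorem exponents_of_isFutile [Infinite R] {ι : Type*} [Fintype ι] {g : ι → R[X]} {n : ι → ℕ}
    (hg : ∀ i, Irreducible (g i)) (hn : ∀ i, 1 ≤ n i)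
    (hfut : IsFutile R (AdjoinRoot (∏ i, g i ^ n i))) (i : ι) (hi : n i ≠ 1) :
    (g i).degree = 1 ∧ n i ≤ 3 ∧ ∀ j, n j ≠ 1 → j = i := by
  classical
  have hpos : ∀ j, 0 < (g j).natDegree := fun j => (hg j).natDegree_pos
  have hf0 : ∏ i, g i ^ n i ≠ 0 :=
    Finset.prod_ne_zero_iff.2 fun j _ => pow_ne_zero _ (hg j).ne_zero
  have key : ∀ q h : R[X], ∏ i, g i ^ n i = q * h → h ∣ q → ¬ 2 ≤ h.natDegree := by
    intro q h hqh hdvd hdeg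
    rw [hqh] at hf0 hfut
    exact not_isFutile_adjoinRoot_mul (left_ne_zero_of_mul hf0) hdvd hdeg hfut
  have hn2 : ∀ j, n j ≠ 1 → ∃ k, n j = k + 2 := fun j hj =>
    ⟨n j - 2, by have := hn j; omega⟩
  have hsplit := Finset.mul_prod_erase Finset.univ (fun j => g j ^ n j) (Finset.mem_univ i)
  refine ⟨?_, ?_, fun j hj => ?_⟩
  · obtain ⟨k, hk⟩ := hn2 i hi
    have := key (g i ^ (k + 1) * ∏ j ∈ Finset.univ.erase i, g j ^ n j) (g i)
      (by rw [← hsplit, hk]; ring) ((dvd_pow_self _ k.succ_ne_zero).mul_right _)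
    rw [show (1 : WithBot ℕ) = (1 : ℕ) from rfl, degree_eq_iff_natDegree_eq_of_pos one_pos]
    have := hpos i
    omega
  · by_contra hlt
    obtain ⟨k, hk⟩ : ∃ k, n i = k + 4 := ⟨n i - 4, by omega⟩
    refine key (g i ^ (k + 2) * ∏ j ∈ Finset.univ.erase i, g j ^ n j) (g i ^ 2)
      (by rw [← hsplit, hk]; ring) ((pow_dvd_pow _ (by omega)).mul_right _) ?_
    rw [natDegree_pow]
    have := hpos i
    omega
  · by_contra hij
    obtain ⟨k, hk⟩ := hn2 i hi
    obtain ⟨l, hl⟩ := hn2 j hj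
    have hsplit' := Finset.mul_prod_erase (Finset.univ.erase i) (fun j => g j ^ n j)
      (Finset.mem_erase.2 ⟨hij, Finset.mem_univ j⟩)
    refine key (g i ^ (k + 1) * g j ^ (l + 1) *
      ∏ x ∈ (Finset.univ.erase i).erase j, g x ^ n x) (g i * g j)
      (by rw [← hsplit, ← hsplit', hk, hl]; ring)
      ((mul_dvd_mul (dvd_pow_self _ k.succ_ne_zero) (dvd_pow_self _ l.succ_ne_zero)).mul_right _) ?_
    rw [natDegree_mul (hg i).ne_zero (hg j).ne_zero]
    have := hpos i
    have := hpos j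
    omega

end Field

/-- Let `R` be an infinite field. An `R`-algebra `A` is futile if and only if
`A ≅ R[x]/(f)` for a nonzero polynomial `f = ∏ᵢ fᵢ^{nᵢ}` with the `fᵢ` monic irreducible and
pairwise coprime, where `nᵢ = 1` for all but possibly one index `i`, and for that
exceptional index one has `deg fᵢ = 1` and `nᵢ ≤ 3`. -/
theorem isFutile_iff_quotient_polynomial (R A : Type*) [Field R] [Infinite R]
    [Ring A] [Algebra R A] :
    IsFutile R A ↔
      ∃ (f : Polynomial R) (m : ℕ) (g : Fin m → Polynomial R) (n : Fin m → ℕ),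
        f ≠ 0 ∧
        Nonempty (A ≃ₐ[R] Polynomial R ⧸ Ideal.span {f}) ∧
        f = ∏ i, g i ^ n i ∧
        (∀ i, (g i).Monic ∧ Irreducible (g i)) ∧
        (Pairwise fun i j => IsCoprime (g i) (g j)) ∧
        (∀ i, 1 ≤ n i) ∧
        (∀ i, n i ≠ 1 → (g i).degree = 1 ∧ n i ≤ 3 ∧ ∀ j, n j ≠ 1 → j = i) := by
  constructor
  · intro hA
    obtain ⟨f, hf, ⟨e⟩⟩ := hA.exists_equiv_adjoinRoot
    obtain ⟨m, g, n, hprod, hg, hco, hn⟩ := exists_prod_irreducible_pow hf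
    have hfut : IsFutile R (AdjoinRoot (∏ i, g i ^ n i)) := hprod ▸ (isFutile_congr e).1 hA
    exact ⟨f, m, g, n, hf.ne_zero, ⟨e⟩, hprod, hg, hco, hn,
      exponents_of_isFutile (fun i => (hg i).2) hn hfut⟩
  · rintro ⟨f, m, g, n, -, ⟨e⟩, hprod, hg, hco, -, hexp⟩
    have hfut : IsFutile R (AdjoinRoot f) := hprod ▸ isFutile_adjoinRoot_prod hg hco hexp
    exact (isFutile_congr (B := AdjoinRoot f) e).2 hfut
end

section
/- Let R be a commutative ring, A an R-algebra and I ⊆ A a two-sided ideal which is a finite set. Then A is an R-futile algebra if and only if A/I is an R-futile algebra. -/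
/-- The quotient of an `R`-algebra by a two-sided ideal is again an `R`-algebra. -/
instance twoSidedQuotAlgebra {R A : Type*} [CommRing R] [Ring A] [Algebra R A]
    (I : TwoSidedIdeal A) : Algebra R I.ringCon.Quotient :=
  RingHom.toAlgebra' ((RingCon.mk' I.ringCon).comp (algebraMap R A)) (by
    intro c x
    induction x using Quotient.inductionOn' with
    | h a => exact congrArg (Quotient.mk'') (Algebra.commutes c a))

/-- The quotient map by a two-sided ideal, as an algebra homomorphism. -/
def twoSidedQuotMk (R : Type*) {A : Type*} [CommRing R] [Ring A] [Algebra R A]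
    (I : TwoSidedIdeal A) : A →ₐ[R] I.ringCon.Quotient :=
  { RingCon.mk' I.ringCon with commutes' := fun _ => rfl }

theorem twoSidedQuotMk_surjective (R : Type*) {A : Type*} [CommRing R] [Ring A] [Algebra R A]
    (I : TwoSidedIdeal A) : Function.Surjective (twoSidedQuotMk R I) :=
  RingCon.mk'_surjective I.ringCon

theorem twoSidedQuotMk_eq_iff (R : Type*) {A : Type*} [CommRing R] [Ring A] [Algebra R A]
    (I : TwoSidedIdeal A) (a b : A) :
    twoSidedQuotMk R I a = twoSidedQuotMk R I b ↔ a - b ∈ I :=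
  (RingCon.eq I.ringCon).trans (TwoSidedIdeal.rel_iff I a b)

/-- A futile algebra has a finite subset that detects inclusions between subalgebras. -/
theorem IsFutile.exists_finite_detecting {R A : Type*} [CommRing R] [Ring A] [Algebra R A]
    (h : IsFutile R A) :
    ∃ S : Set A, S.Finite ∧ ∀ D E : Subalgebra R A, (∀ x ∈ D, x ∈ S → x ∈ E) → D ≤ E := by
  have : Finite (Subalgebra R A) := h
  have key : ∀ p : Subalgebra R A × Subalgebra R A,
      ∃ x : A, ¬ p.1 ≤ p.2 → x ∈ p.1 ∧ x ∉ p.2 := by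
    intro p
    by_cases hp : p.1 ≤ p.2
    · exact ⟨0, fun h => absurd hp h⟩
    · obtain ⟨x, hx⟩ := SetLike.not_le_iff_exists.mp hp
      exact ⟨x, fun _ => hx⟩
  choose f hf using key
  refine ⟨Set.range f, Set.finite_range f, fun D E hDE => ?_⟩
  by_contra hle
  obtain ⟨hD, hE⟩ := hf (D, E) hle
  exact hE (hDE _ hD ⟨_, rfl⟩)

/-- Futility passes to the target of a surjective algebra homomorphism. -/
theorem IsFutile.of_surjective {R A B : Type*} [CommRing R] [Ring A] [Algebra R A]
    [Ring B] [Algebra R B] (h : IsFutile R A) (π : A →ₐ[R] B) (hπ : Function.Surjective π) :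
    IsFutile R B :=
  haveI : Finite (Subalgebra R A) := h
  Finite.of_injective (fun D : Subalgebra R B => D.comap π)
    fun _ _ hDE => SetLike.coe_injective (hπ.preimage_injective (congrArg SetLike.coe hDE))

/-- Futility lifts along an algebra homomorphism with finite fibres. -/
theorem IsFutile.of_finite_fibers {R A B : Type*} [CommRing R] [Ring A] [Algebra R A]
    [Ring B] [Algebra R B] (h : IsFutile R B) (π : A →ₐ[R] B)
    (hfib : ∀ b, (π ⁻¹' {b}).Finite) : IsFutile R A := by
  obtain ⟨S, hS, hdet⟩ := h.exists_finite_detecting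
  let T : Set A := π ⁻¹' (insert 0 S)
  have hTfin : T.Finite := (hS.insert 0).preimage' fun b _ => hfib b
  have hle : ∀ C D : Subalgebra R A, (C : Set A) ∩ T = (D : Set A) ∩ T → C ≤ D := by
    intro C D hCD
    have hCT : ∀ x ∈ C, x ∈ T → x ∈ C ⊓ D := fun x hx hxT =>
      ⟨hx, (hCD.subset ⟨hx, hxT⟩).1⟩
    have hmap : C.map π ≤ (C ⊓ D).map π := by
      refine hdet _ _ ?_
      rintro _ ⟨x, hx, rfl⟩ hxS
      exact ⟨x, hCT x hx (Or.inr hxS), rfl⟩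
    intro c hc
    obtain ⟨d, hd, hdc⟩ := hmap ⟨c, hc, rfl⟩
    have hsub : c - d ∈ C ⊓ D :=
      hCT _ (C.sub_mem hc hd.1) (Or.inl ((map_sub π c d).trans (sub_eq_zero.mpr hdc.symm)))
    simpa using D.add_mem hsub.2 hd.2
  have : Finite (𝒫 T) := hTfin.finite_subsets
  refine Finite.of_injective
    (fun C : Subalgebra R A => (⟨(C : Set A) ∩ T, Set.inter_subset_right⟩ : 𝒫 T)) ?_
  intro C D hCD
  have hCD' := congrArg Subtype.val hCD
  exact le_antisymm (hle C D hCD') (hle D C hCD'.symm)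

/-- Let `I ⊆ A` be a two-sided ideal which is a finite set. Then `A` is a futile `R`-algebra
if and only if `A/I` is a futile `R`-algebra. -/
theorem isFutile_iff_quotient_isFutile_of_finite_twoSidedIdeal
    {R A : Type*} [CommRing R] [Ring A] [Algebra R A]
    (I : TwoSidedIdeal A) (hI : (I : Set A).Finite) :
    IsFutile R A ↔ IsFutile R I.ringCon.Quotient := by
  refine ⟨fun h => h.of_surjective _ (twoSidedQuotMk_surjective R I),
    fun h => h.of_finite_fibers (twoSidedQuotMk R I) fun b => ?_⟩
  obtain ⟨a, rfl⟩ := twoSidedQuotMk_surjective R I b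
  refine (hI.image (· + a)).subset fun x hx => ?_
  exact ⟨x - a, (twoSidedQuotMk_eq_iff R I x a).mp hx, sub_add_cancel x a⟩
end

section
/- Let R be a principal ideal domain with fraction field Q(R). Then an R-subalgebra A of Q(R) is R-futile if and only if A = R[1/r] for some r ∈ R \ {0}, where R[1/r] is the R-subalgebra of Q(R) generated by 1/r. -/
section FractionField

variable {R K : Type*} [CommRing R] [Field K] [Algebra R K]

theorem inv_algebraMap_mem_of_dvd {B : Subalgebra R K} {b c : R}
    (hc : algebraMap R K c ≠ 0) (hcB : (algebraMap R K c)⁻¹ ∈ B) (hbc : b ∣ c) :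
    (algebraMap R K b)⁻¹ ∈ B := by
  obtain ⟨d, rfl⟩ := hbc
  rw [map_mul] at hc hcB
  have hd : algebraMap R K d ≠ 0 := right_ne_zero_of_mul hc
  have h := B.mul_mem (B.algebraMap_mem d) hcB
  rwa [mul_inv_rev, mul_inv_cancel_left₀ hd] at h

theorem exists_algebraMap_eq_pow_mul_of_mem_adjoin_inv {r : R} (hr : algebraMap R K r ≠ 0) {x : K}
    (hx : x ∈ Algebra.adjoin R {(algebraMap R K r)⁻¹}) :
    ∃ (n : ℕ) (c : R), algebraMap R K c = algebraMap R K r ^ n * x := by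
  induction hx using Algebra.adjoin_induction with
  | mem x hx =>
    rw [Set.mem_singleton_iff] at hx
    exact ⟨1, 1, by simp [hx, hr]⟩
  | algebraMap a => exact ⟨0, a, by simp⟩
  | add x y _ _ hx hy =>
    obtain ⟨n, c, hc⟩ := hx
    obtain ⟨m, d, hd⟩ := hy
    exact ⟨n + m, r ^ m * c + r ^ n * d, by simp only [map_add, map_mul, map_pow, hc, hd]; ring⟩
  | mul x y _ _ hx hy =>
    obtain ⟨n, c, hc⟩ := hx
    obtain ⟨m, d, hd⟩ := hy
    exact ⟨n + m, c * d, by simp only [map_mul, hc, hd]; ring⟩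

variable [IsFractionRing R K]

theorem Prime.dvd_of_inv_mem_adjoin_inv {p r : R} (hp : Prime p) (hr : r ≠ 0)
    (h : (algebraMap R K p)⁻¹ ∈ Algebra.adjoin R {(algebraMap R K r)⁻¹}) : p ∣ r := by
  have hinj := IsFractionRing.injective R K
  have hpK : algebraMap R K p ≠ 0 := (map_ne_zero_iff _ hinj).2 hp.ne_zero
  obtain ⟨n, c, hc⟩ := exists_algebraMap_eq_pow_mul_of_mem_adjoin_inv
    ((map_ne_zero_iff _ hinj).2 hr) h
  refine hp.dvd_of_dvd_pow (n := n) ⟨c, hinj ?_⟩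
  rw [map_mul, hc, map_pow]
  field_simp

variable [IsDomain R] [IsPrincipalIdealRing R]

/-- Over a principal ideal domain, a subalgebra of the fraction field that contains `x` contains
the inverse of the reduced denominator of `x`. -/
theorem exists_eq_algebraMap_mul_inv_forall_inv_mem (x : K) :
    ∃ a b : R, b ≠ 0 ∧ x = algebraMap R K a * (algebraMap R K b)⁻¹ ∧
      ∀ B : Subalgebra R K, x ∈ B → (algebraMap R K b)⁻¹ ∈ B := by
  obtain ⟨a, b, hab, rfl⟩ := IsFractionRing.exists_reduced_fraction (A := R) x
  have hb : (b : R) ≠ 0 := nonZeroDivisors.coe_ne_zero b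
  have hbK : algebraMap R K b ≠ 0 := IsFractionRing.to_map_ne_zero_of_mem_nonZeroDivisors b.2
  have hx : IsLocalization.mk' K a b = algebraMap R K a * (algebraMap R K b)⁻¹ := by
    rw [IsFractionRing.mk'_eq_div, div_eq_mul_inv]
  refine ⟨a, b, hb, hx, fun B hB => ?_⟩
  rw [hx] at hB
  obtain ⟨u, v, huv⟩ := hab.isCoprime
  have huv' : algebraMap R K u * algebraMap R K a + algebraMap R K v * algebraMap R K b = 1 := by
    simpa using congrArg (algebraMap R K) huv
  have h : (algebraMap R K b)⁻¹ =
      algebraMap R K u * (algebraMap R K a * (algebraMap R K b)⁻¹) + algebraMap R K v := by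
    field_simp
    linear_combination -huv'
  rw [h]
  exact B.add_mem (B.mul_mem (B.algebraMap_mem u) hB) (B.algebraMap_mem v)

/-- Subalgebras of `R[1/r]` are compared by the prime factors of `r` that they invert. -/
theorem Subalgebra.le_of_forall_mem_factors {r : R} (hr : r ≠ 0) {B C : Subalgebra R K}
    (hB : B ≤ Algebra.adjoin R {(algebraMap R K r)⁻¹})
    (h : ∀ p ∈ UniqueFactorizationMonoid.factors r,
      (algebraMap R K p)⁻¹ ∈ B → (algebraMap R K p)⁻¹ ∈ C) : B ≤ C := by
  have hinj := IsFractionRing.injective R K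
  have key (b : R) (hb : b ≠ 0) : (algebraMap R K b)⁻¹ ∈ B → (algebraMap R K b)⁻¹ ∈ C := by
    induction b using UniqueFactorizationMonoid.induction_on_prime with
    | h₁ => exact absurd rfl hb
    | h₂ u hu =>
      intro _
      exact inv_algebraMap_mem_of_dvd (c := 1) (by simp) (by simp) hu.dvd
    | h₃ b p hb' hp ih =>
      intro hmem
      have hne := (map_ne_zero_iff _ hinj).2 hb
      have hpB := inv_algebraMap_mem_of_dvd hne hmem (dvd_mul_right p b)
      have hpr : p ∣ r := hp.dvd_of_inv_mem_adjoin_inv hr (hB hpB)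
      obtain ⟨q, hq, hpq⟩ :=
        UniqueFactorizationMonoid.exists_mem_factors_of_dvd hr hp.irreducible hpr
      have hpK : algebraMap R K p ≠ 0 := (map_ne_zero_iff _ hinj).2 hp.ne_zero
      have hqK : algebraMap R K q ≠ 0 :=
        (map_ne_zero_iff _ hinj).2 (hpq.ne_zero_iff.1 hp.ne_zero)
      have hqC := h q hq (inv_algebraMap_mem_of_dvd hpK hpB hpq.symm.dvd)
      rw [map_mul, mul_inv]
      exact C.mul_mem (inv_algebraMap_mem_of_dvd hqK hqC hpq.dvd)
        (ih hb' (inv_algebraMap_mem_of_dvd hne hmem (dvd_mul_left b p)))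
  intro x hx
  obtain ⟨a, b, hb, rfl, hden⟩ := exists_eq_algebraMap_mul_inv_forall_inv_mem (R := R) x
  exact C.mul_mem (C.algebraMap_mem a) (key b hb (hden B hx))

theorem isFutile_adjoin_inv {r : R} (hr : r ≠ 0) :
    IsFutile R (Algebra.adjoin R {(algebraMap R K r)⁻¹}) := by
  let A := Algebra.adjoin R {(algebraMap R K r)⁻¹}
  let f (B : Subalgebra R A) : Set {p // p ∈ UniqueFactorizationMonoid.factors r} :=
    {p | (algebraMap R K p)⁻¹ ∈ B.map A.val}
  have hfin : Finite {p // p ∈ UniqueFactorizationMonoid.factors r} :=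
    (Multiset.finite_toSet _).to_subtype
  have hle (B : Subalgebra R A) : B.map A.val ≤ A := by
    rintro _ ⟨x, -, rfl⟩
    exact x.2
  refine Finite.of_injective f fun B C hBC => ?_
  refine Subalgebra.map_injective (f := A.val) Subtype.val_injective (le_antisymm ?_ ?_)
  · exact Subalgebra.le_of_forall_mem_factors hr (hle B) fun p hp hpB =>
      (Set.ext_iff.1 hBC ⟨p, hp⟩).1 hpB
  · exact Subalgebra.le_of_forall_mem_factors hr (hle C) fun p hp hpC =>
      (Set.ext_iff.1 hBC ⟨p, hp⟩).2 hpC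

theorem IsFutile.exists_eq_adjoin_inv {A : Subalgebra R K} (hA : IsFutile R A) :
    ∃ r : R, r ≠ 0 ∧ A = Algebra.adjoin R {(algebraMap R K r)⁻¹} := by
  have hinj := IsFractionRing.injective R K
  have : Finite (Subalgebra R A) := hA
  let s : Set (Subalgebra R K) :=
    {B | B ≤ A ∧ ∃ r : R, r ≠ 0 ∧ B = Algebra.adjoin R {(algebraMap R K r)⁻¹}}
  have hs : s.Finite := by
    refine (Set.finite_range (Subalgebra.map A.val)).subset fun B hB => ⟨B.comap A.val, ?_⟩
    rw [Subalgebra.map_comap_eq_self]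
    exact A.range_val.symm ▸ hB.1
  have hne : s.Nonempty :=
    ⟨_, Algebra.adjoin_le (by simp), 1, one_ne_zero, rfl⟩
  obtain ⟨B, ⟨hBA, r, hr, rfl⟩, hmax⟩ := hs.exists_maximal hne
  refine ⟨r, hr, le_antisymm (fun x hx => ?_) hBA⟩
  obtain ⟨a, b, hb, rfl, hden⟩ := exists_eq_algebraMap_mul_inv_forall_inv_mem (R := R) x
  have hrb : algebraMap R K (r * b) ≠ 0 := (map_ne_zero_iff _ hinj).2 (mul_ne_zero hr hb)
  have hself := Algebra.self_mem_adjoin_singleton R (algebraMap R K (r * b))⁻¹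
  have hle : Algebra.adjoin R {(algebraMap R K (r * b))⁻¹} ≤ A := by
    refine Algebra.adjoin_le (Set.singleton_subset_iff.2 ?_)
    rw [map_mul, mul_inv]
    exact A.mul_mem (hBA (Algebra.self_mem_adjoin_singleton R _)) (hden A hx)
  have hge := hmax ⟨hle, r * b, mul_ne_zero hr hb, rfl⟩
    (Algebra.adjoin_le (Set.singleton_subset_iff.2
      (inv_algebraMap_mem_of_dvd hrb hself (dvd_mul_right r b))))
  exact Subalgebra.mul_mem _ (Subalgebra.algebraMap_mem _ a)
    (hge (inv_algebraMap_mem_of_dvd hrb hself (dvd_mul_left b r)))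

end FractionField

/-- Let `R` be a principal ideal domain with fraction field `Q(R)`. An `R`-subalgebra `A` of
`Q(R)` is `R`-futile if and only if `A = R[1/r]` for some nonzero `r ∈ R`. -/
theorem subalgebra_of_fractionField_futile_iff
    {R : Type*} [CommRing R] [IsDomain R] [IsPrincipalIdealRing R]
    (A : Subalgebra R (FractionRing R)) :
    IsFutile R A ↔
      ∃ r : R, r ≠ 0 ∧ A = Algebra.adjoin R {(algebraMap R (FractionRing R) r)⁻¹} := by
  refine ⟨IsFutile.exists_eq_adjoin_inv, ?_⟩
  rintro ⟨r, hr, rfl⟩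
  exact isFutile_adjoin_inv hr
end

section
/- Let L/K be an algebraic extension of fields and let L_{K,sep} denote the separable closure of K in L. Then the map E ↦ (E ∩ L_{K,sep}, E·L_{K,sep}), from the set of intermediate fields of L/K to the product of the set of intermediate fields of L_{K,sep}/K and the set of intermediate fields of L/L_{K,sep}, is injective. Its image consists exactly of the pairs (E₁, E₂) with E₁ ⊆ E₂ such that E₂ is separably disjoint over E₁, i.e. E₂ is the compositum of the separable closure of E₁ in E₂ and the purely inseparable closure {x ∈ E₂ : ∃ j, x^{p^j} ∈ E₁} of E₁ in E₂ (p the characteristic exponent). -/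
/-- The characteristic exponent of a field: its characteristic if that is nonzero,
and `1` otherwise. -/
noncomputable def charExponent (K : Type*) [Field K] : ℕ :=
  if ringChar K = 0 then 1 else ringChar K

theorem charExponent_eq_ringExpChar (K : Type*) [Field K] : charExponent K = ringExpChar K := by
  unfold charExponent ringExpChar
  split_ifs <;> omega

instance expChar_charExponent (K : Type*) [Field K] : ExpChar K (charExponent K) :=
  charExponent_eq_ringExpChar K ▸ inferInstance

namespace IntermediateField

variable {K L : Type*} [Field K] [Field L] [Algebra K L]

theorem mem_restrictScalars_perfectClosure_iff (q : ℕ) [ExpChar K q] (F : IntermediateField K L)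
    {x : L} : x ∈ (perfectClosure F L).restrictScalars K ↔ ∃ j : ℕ, x ^ q ^ j ∈ F := by
  have : ExpChar F q := expChar_of_injective_algebraMap (algebraMap K F).injective q
  rw [mem_restrictScalars, mem_perfectClosure_iff_pow_mem q]
  simp

theorem mem_of_isSeparable_of_pow_mem (q : ℕ) [ExpChar K q] (F : IntermediateField K L) {x : L}
    (hs : IsSeparable F x) {j : ℕ} (hj : x ^ q ^ j ∈ F) : x ∈ F := by
  have hx : x ∈ separableClosure F L ⊓ perfectClosure F L :=
    ⟨hs, (mem_restrictScalars_perfectClosure_iff q F).2 ⟨j, hj⟩⟩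
  rw [separableClosure_inf_perfectClosure, mem_bot] at hx
  obtain ⟨y, rfl⟩ := hx
  exact y.2

theorem isSeparable_of_mem_sup_separableClosure (E : IntermediateField K L) {x : L}
    (hx : x ∈ E ⊔ separableClosure K L) : IsSeparable E x :=
  (sup_le (le_restrictScalars_separableClosure E)
    (separableClosure.le_restrictScalars K E L) :
      E ⊔ separableClosure K L ≤ (separableClosure E L).restrictScalars K) hx

theorem exists_pow_mem_inf_separableClosure [Algebra.IsAlgebraic K L] (q : ℕ) [ExpChar K q]
    (E : IntermediateField K L) {x : L} (hx : x ∈ E) :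
    ∃ j : ℕ, x ^ q ^ j ∈ E ⊓ separableClosure K L := by
  have hxS : x ∈ (perfectClosure (separableClosure K L) L).restrictScalars K := by
    rw [mem_restrictScalars, isPurelyInseparable_iff_perfectClosure_eq_top.1 inferInstance]
    trivial
  obtain ⟨j, hj⟩ := (mem_restrictScalars_perfectClosure_iff q _).1 hxS
  exact ⟨j, pow_mem hx _, hj⟩

/-- An intermediate field `E` is the purely inseparable closure of `E ⊓ separableClosure K L`
in `E ⊔ separableClosure K L`. -/
theorem mem_iff_mem_sup_and_exists_pow_mem_inf [Algebra.IsAlgebraic K L] (q : ℕ) [ExpChar K q]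
    (E : IntermediateField K L) {x : L} :
    x ∈ E ↔ x ∈ E ⊔ separableClosure K L ∧ ∃ j : ℕ, x ^ q ^ j ∈ E ⊓ separableClosure K L :=
  ⟨fun hx ↦ ⟨le_sup_left (a := E) hx, exists_pow_mem_inf_separableClosure q E hx⟩,
    fun ⟨hx, _, hj⟩ ↦
      mem_of_isSeparable_of_pow_mem q E (isSeparable_of_mem_sup_separableClosure E hx) hj.1⟩

/-- If `F` is separable over `K`, then an element of `L` is separable over `F` if and only if it
is separable over `K`. -/
theorem isSeparable_iff_mem_separableClosure {F : IntermediateField K L}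
    (hF : F ≤ separableClosure K L) {x : L} : IsSeparable F x ↔ x ∈ separableClosure K L := by
  have := (le_separableClosure_iff K L F).1 hF
  rw [separableClosure.eq_restrictScalars_of_isSeparable K F L]
  rfl

end IntermediateField

/-- Let `L/K` be an algebraic extension of fields with `L_{K,sep}` the separable closure of
`K` in `L`. The map `E ↦ (E ∩ L_{K,sep}, E·L_{K,sep})` on intermediate fields of `L/K` is
injective, and its image consists exactly of the pairs `(E₁, E₂)` with
`E₁ ⊆ L_{K,sep}`, `L_{K,sep} ⊆ E₂`, `E₁ ⊆ E₂`, such that `E₂` is separably disjoint over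
`E₁`, i.e. `E₂` is generated by the set of elements of `E₂` separable over `E₁` together
with the set of elements of `E₂` purely inseparable over `E₁`. -/
theorem intermediateField_sep_insep_decomposition
    (K L : Type*) [Field K] [Field L] [Algebra K L] [Algebra.IsAlgebraic K L] :
    Function.Injective
      (fun E : IntermediateField K L => (E ⊓ separableClosure K L, E ⊔ separableClosure K L)) ∧
    Set.range
      (fun E : IntermediateField K L =>
        (E ⊓ separableClosure K L, E ⊔ separableClosure K L)) =
      {P : IntermediateField K L × IntermediateField K L |
        P.1 ≤ separableClosure K L ∧ separableClosure K L ≤ P.2 ∧ P.1 ≤ P.2 ∧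
        P.2 = IntermediateField.adjoin K
          ({x : L | x ∈ P.2 ∧ IsSeparable P.1 x} ∪
           {x : L | x ∈ P.2 ∧ ∃ j : ℕ, x ^ (charExponent K) ^ j ∈ P.1})} := by
  set S := separableClosure K L
  let q := charExponent K
  refine ⟨fun E E' h ↦ ?_, Set.ext fun P ↦ ⟨?_, ?_⟩⟩
  · obtain ⟨h₁, h₂⟩ := Prod.mk.inj h
    ext x
    rw [E.mem_iff_mem_sup_and_exists_pow_mem_inf q, E'.mem_iff_mem_sup_and_exists_pow_mem_inf q,
      h₁, h₂]
  · rintro ⟨E, rfl⟩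
    refine ⟨inf_le_right, le_sup_right, inf_le_left.trans le_sup_left, le_antisymm ?_ ?_⟩
    · refine sup_le (fun x hx ↦ ?_) (fun x hx ↦ ?_) <;> apply IntermediateField.subset_adjoin
      · exact .inr ((E.mem_iff_mem_sup_and_exists_pow_mem_inf q).1 hx)
      · exact .inl ⟨le_sup_right (a := E) hx,
          (IntermediateField.isSeparable_iff_mem_separableClosure inf_le_right).2 hx⟩
    · rw [IntermediateField.adjoin_le_iff]
      rintro x (hx | hx) <;> exact hx.1
  · obtain ⟨E₁, E₂⟩ := P
    rintro ⟨h₁, h₂, h₁₂, hE₂⟩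
    dsimp only at h₁ h₂ h₁₂ hE₂
    refine ⟨E₂ ⊓ (perfectClosure E₁ L).restrictScalars K, Prod.ext ?_ ?_⟩
    · refine le_antisymm (fun x hx ↦ ?_) (fun x hx ↦ ⟨⟨h₁₂ hx, ?_⟩, h₁ hx⟩)
      · obtain ⟨j, hj⟩ := (E₁.mem_restrictScalars_perfectClosure_iff q).1 hx.1.2
        exact E₁.mem_of_isSeparable_of_pow_mem q
          ((IntermediateField.isSeparable_iff_mem_separableClosure h₁).2 hx.2) hj
      · exact (E₁.mem_restrictScalars_perfectClosure_iff q).2 ⟨0, by simpa using hx⟩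
    · refine le_antisymm (sup_le inf_le_left h₂) (hE₂.le.trans ?_)
      rw [IntermediateField.adjoin_le_iff]
      rintro x (⟨-, hx⟩ | ⟨hx, hj⟩)
      · exact le_sup_right (b := S)
          ((IntermediateField.isSeparable_iff_mem_separableClosure h₁).1 hx)
      · exact le_sup_left (b := S) ⟨hx, (E₁.mem_restrictScalars_perfectClosure_iff q).2 hj⟩
end
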